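/- arXiv:1511.01365 — 5 statements merged into one kernel-verified Lean document; each statement's English description precedes it below -/
import Mathlib

section
/- The constrained storage problem and the modified unconstrained problem have equal optimal values: the supremum over u ∈ U_C of E[∫_0^T (p(t) − u(t)) S(t) dt + y_u(T) S(T)] is equal to the supremum, taken over all u ∈ U and all continuous adapted processes ŷ that satisfy ŷ(s) = y_0 + ∫_0^s u(r)·1{ŷ(r) ≤ C} dr for all s ∈ [0,T] almost surely, of E[∫_0^T 1{ŷ(t) ≥ 0} (p(t) − u(t)) S(t) dt + ŷ(T) S(T)]. -/
open MeasureTheory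

section Paths

variable {u : ℝ → ℝ} {L : ℝ}

/-- A bounded measurable function of time is interval integrable. -/
theorem intervalIntegrable_of_measurable_of_abs_le (hu : Measurable u) (hL : ∀ t, |u t| ≤ L)
    (a b : ℝ) : IntervalIntegrable u volume a b := by
  refine (intervalIntegrable_const (c := L)).mono_fun hu.aestronglyMeasurable ?_
  exact Filter.Eventually.of_forall fun t => by
    simpa only [Real.norm_eq_abs] using (hL t).trans (le_abs_self L)

theorem lipschitzWith_integral_of_abs_le (hu : Measurable u) (hL : ∀ t, |u t| ≤ L) (y₀ : ℝ) :
    LipschitzWith L.toNNReal fun s => y₀ + ∫ r in (0 : ℝ)..s, u r := by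
  have hL0 : 0 ≤ L := (abs_nonneg _).trans (hL 0)
  have hint := intervalIntegrable_of_measurable_of_abs_le hu hL
  refine LipschitzWith.of_dist_le_mul fun a b => ?_
  rw [Real.dist_eq, Real.dist_eq, add_sub_add_left_eq_sub,
    intervalIntegral.integral_interval_sub_left (hint 0 a) (hint 0 b), Real.coe_toNNReal _ hL0]
  exact intervalIntegral.norm_integral_le_of_norm_le_const (f := u) fun t _ => hL t

/-- A path whose rate is switched off above the level `C` never exceeds `C`. -/
theorem le_of_eq_integral_truncated {y : ℝ → ℝ} {y₀ C T : ℝ} (hu : Measurable u)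
    (hL : ∀ t, |u t| ≤ L) (hy : Continuous y) (hy₀ : y₀ ≤ C)
    (heq : ∀ s ∈ Set.Icc 0 T, y s = y₀ + ∫ r in (0 : ℝ)..s, if y r ≤ C then u r else 0)
    {s : ℝ} (hs : s ∈ Set.Icc 0 T) : y s ≤ C := by
  by_contra! hlt
  have hL0 : 0 ≤ L := (abs_nonneg _).trans (hL 0)
  have hy0 : y 0 = y₀ := by simpa using heq 0 ⟨le_rfl, hs.1.trans hs.2⟩
  have hcpt : IsCompact (Set.Icc 0 s ∩ {t | y t ≤ C}) :=
    isCompact_Icc.inter_right (isClosed_le hy continuous_const)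
  obtain ⟨t, ⟨htI, htC⟩, hmax⟩ := hcpt.exists_isGreatest ⟨0, ⟨le_rfl, hs.1⟩, hy0.trans_le hy₀⟩
  have hint (a b : ℝ) :
      IntervalIntegrable (fun r => if y r ≤ C then u r else 0) volume a b := by
    refine intervalIntegrable_of_measurable_of_abs_le (L := L)
      (hu.ite (measurableSet_le hy.measurable measurable_const) measurable_const) (fun r => ?_) a b
    split_ifs
    · exact hL r
    · simpa using hL0
  have hzero : ∫ r in t..s, (if y r ≤ C then u r else 0) = 0 := by
    refine intervalIntegral.integral_zero_ae (Filter.Eventually.of_forall fun r hr => ?_)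
    rw [Set.uIoc_of_le htI.2] at hr
    refine if_neg fun hrC => ?_
    exact hr.1.not_ge (hmax ⟨⟨htI.1.trans hr.1.le, hr.2⟩, hrC⟩)
  have hsplit := intervalIntegral.integral_add_adjacent_intervals (hint 0 t) (hint t s)
  have hys := heq s hs
  have hyt := heq t ⟨htI.1, htI.2.trans hs.2⟩
  have htC' : y t ≤ C := htC
  linarith

/-- The positive part of a path has rate `u` while the path is nonnegative, and `0` otherwise. -/
theorem integral_ite_nonneg_eq_max (hu : Measurable u) (hL : ∀ t, |u t| ≤ L) {y₀ : ℝ}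
    (hy₀ : 0 ≤ y₀) (s : ℝ) :
    y₀ + (∫ r in (0 : ℝ)..s, if 0 ≤ y₀ + ∫ q in (0 : ℝ)..r, u q then u r else 0)
      = max (y₀ + ∫ r in (0 : ℝ)..s, u r) 0 := by
  set Y : ℝ → ℝ := fun s => y₀ + ∫ r in (0 : ℝ)..s, u r with hY
  have hlip : LipschitzWith L.toNNReal Y := lipschitzWith_integral_of_abs_le hu hL y₀
  have hpos : LipschitzWith L.toNNReal fun t => max (Y t) 0 := hlip.max_const 0
  have hneg : LipschitzWith L.toNNReal fun t => max (-Y t) 0 := hlip.neg.max_const 0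
  have hloc : LocallyIntegrable u volume := by
    refine (locallyIntegrable_const L).mono hu.aestronglyMeasurable ?_
    exact Filter.Eventually.of_forall fun t => by
      simpa only [Real.norm_eq_abs] using (hL t).trans (le_abs_self L)
  have hderiv : ∀ᵐ t, deriv (fun t => max (Y t) 0) t = if 0 ≤ Y t then u t else 0 := by
    filter_upwards [hpos.ae_differentiableAt_real, hneg.ae_differentiableAt_real,
      LocallyIntegrable.ae_hasDerivAt_integral hloc] with t hpt hnt hut
    have hYt : HasDerivAt Y (u t) t := (hut 0).const_add y₀
    rcases lt_trichotomy (Y t) 0 with h | h | h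
    · have heq : (fun t => max (Y t) 0) =ᶠ[nhds t] fun _ => 0 := by
        filter_upwards [hlip.continuous.continuousAt.eventually_lt_const h] with r hr
        exact max_eq_right hr.le
      rw [heq.deriv_eq, if_neg h.not_ge, deriv_const]
    · have hp0 : deriv (fun t => max (Y t) 0) t = 0 :=
        IsLocalMin.deriv_eq_zero (Filter.Eventually.of_forall fun r => by simp [h])
      have hn0 : deriv (fun t => max (-Y t) 0) t = 0 :=
        IsLocalMin.deriv_eq_zero (Filter.Eventually.of_forall fun r => by simp [h])
      have hsub : HasDerivAt Y (0 - 0) t := by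
        have := hpt.hasDerivAt.sub hnt.hasDerivAt
        rw [hp0, hn0] at this
        refine this.congr_of_eventuallyEq (Filter.Eventually.of_forall fun r => ?_)
        simpa [max_comm] using (max_zero_sub_max_neg_zero_eq_self (Y r)).symm
      rw [hp0, if_pos h.ge, hYt.unique hsub, sub_zero]
    · have heq : (fun t => max (Y t) 0) =ᶠ[nhds t] Y := by
        filter_upwards [hlip.continuous.continuousAt.eventually_const_lt h] with r hr
        exact max_eq_left hr.le
      rw [heq.deriv_eq, if_pos h.le, hYt.deriv]
  have hftc := (hpos.lipschitzOnWith (s := Set.uIcc 0 s)).absolutelyContinuousOnInterval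
    |>.integral_deriv_eq_sub
  rw [intervalIntegral.integral_congr_ae (hderiv.mono fun t ht _ => ht)] at hftc
  have hY0 : max (Y 0) 0 = y₀ := by simpa [hY] using hy₀
  simp only [hY0] at hftc
  linarith

end Paths

section Progressive

variable {Ω : Type*} {mΩ : MeasurableSpace Ω} {𝓕 : Filtration ℝ mΩ} {u Y : ℝ → Ω → ℝ}

theorem MeasureTheory.IsStronglyProgressive.stronglyMeasurable_min
    (hu : IsStronglyProgressive 𝓕 u) (s : ℝ) :
    StronglyMeasurable[(borel ℝ).prod (𝓕 s)] fun q : ℝ × Ω => u (min q.1 s) q.2 := by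
  rw [← (BorelSpace.measurable_eq : _ = borel ℝ)]
  let _ : MeasurableSpace Ω := 𝓕 s
  have hmap : Measurable fun q : ℝ × Ω =>
      ((⟨min q.1 s, min_le_right q.1 s⟩ : Set.Iic s), q.2) :=
    ((measurable_fst.min measurable_const).subtype_mk).prodMk measurable_snd
  exact (hu s).comp_measurable hmap

theorem MeasureTheory.IsStronglyProgressive.measurable_path
    (hu : IsStronglyProgressive 𝓕 u) (ω : Ω) : Measurable fun t => u t ω := by
  refine measurable_of_tendsto_metrizable (f := fun (n : ℕ) t => u (min t n) ω) (fun n => ?_) ?_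
  · have h := hu.stronglyMeasurable_min n
    rw [← (BorelSpace.measurable_eq : _ = borel ℝ)] at h
    let _ : MeasurableSpace Ω := 𝓕 n
    exact (h.comp_measurable (measurable_prodMk_right (y := ω))).measurable
  · refine tendsto_pi_nhds.2 fun t => tendsto_const_nhds.congr' ?_
    filter_upwards [Filter.eventually_ge_atTop ⌈t⌉₊] with n hn
    rw [min_eq_left (Nat.ceil_le.1 hn)]

theorem MeasureTheory.IsStronglyProgressive.measurable_integral
    (hu : IsStronglyProgressive 𝓕 u) {s : ℝ} (hs : 0 ≤ s) :
    Measurable[𝓕 s] fun ω => ∫ r in (0 : ℝ)..s, u r ω := by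
  have h := hu.stronglyMeasurable_min s
  rw [← (BorelSpace.measurable_eq : _ = borel ℝ)] at h
  have hcongr : (fun ω => ∫ r in (0 : ℝ)..s, u r ω)
      = fun ω => ∫ r in Set.Ioc 0 s, u (min r s) ω := by
    funext ω
    rw [intervalIntegral.integral_of_le hs]
    refine setIntegral_congr_fun measurableSet_Ioc fun r hr => ?_
    simp only [min_eq_left hr.2]
  rw [hcongr]
  let _ : MeasurableSpace Ω := 𝓕 s
  exact (StronglyMeasurable.integral_prod_left' h).measurable

theorem MeasureTheory.IsStronglyProgressive.adapted_integral
    (hu : IsStronglyProgressive 𝓕 u) (y₀ : ℝ) :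
    Adapted 𝓕 fun s ω => y₀ + ∫ r in (0 : ℝ)..max s 0, u r ω := by
  intro s
  rcases le_total 0 s with hs | hs
  · simpa only [max_eq_left hs] using (hu.measurable_integral hs).const_add y₀
  · simpa only [max_eq_right hs, intervalIntegral.integral_same] using measurable_const

theorem MeasureTheory.IsStronglyProgressive.ite_nonneg
    (hY : IsStronglyProgressive 𝓕 Y) (hu : IsStronglyProgressive 𝓕 u) :
    IsStronglyProgressive 𝓕 fun t ω => if 0 ≤ Y t ω then u t ω else 0 := by
  intro i
  let _ : MeasurableSpace Ω := 𝓕 i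
  exact ((hu i).measurable.ite (measurableSet_le measurable_const (hY i).measurable)
    measurable_const).stronglyMeasurable

theorem MeasureTheory.IsStronglyProgressive.integrable_integral {P : Measure Ω}
    [IsFiniteMeasure P] (hu : IsStronglyProgressive 𝓕 u) {T M : ℝ} (hT : 0 ≤ T)
    (hM : ∀ t ω, |u t ω| ≤ M) : Integrable (fun ω => ∫ t in (0 : ℝ)..T, u t ω) P := by
  refine Integrable.of_bound (C := M * |T - 0|)
    ((hu.measurable_integral hT).mono (𝓕.le T) le_rfl).aestronglyMeasurable ?_
  exact Filter.Eventually.of_forall fun ω =>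
    intervalIntegral.norm_integral_le_of_norm_le_const fun t _ => hM t ω

theorem integrable_running_add_terminal {P : Measure Ω} [IsFiniteMeasure P] {G S : ℝ → Ω → ℝ}
    (hG : IsStronglyProgressive 𝓕 G) (hu : IsStronglyProgressive 𝓕 u)
    (hS : IsStronglyProgressive 𝓕 S) {T M L K : ℝ} (hT : 0 ≤ T) (hM : ∀ t ω, |G t ω| ≤ M)
    (hL : ∀ t ω, |u t ω| ≤ L) (hK : ∀ t ω, |S t ω| ≤ K) (y₀ : ℝ) :
    Integrable (fun ω => (∫ t in (0 : ℝ)..T, G t ω)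
      + (y₀ + ∫ r in (0 : ℝ)..T, u r ω) * S T ω) P :=
  (hG.integrable_integral hT hM).add <|
    ((integrable_const y₀).add (hu.integrable_integral hT hL)).mul_bdd
      (c := K) ((hS.stronglyAdapted T).mono (𝓕.le T)).aestronglyMeasurable
      (Filter.Eventually.of_forall fun ω => hK T ω)

end Progressive

/-- The constrained single-battery storage problem and the modified
(capacity-truncated, unconstrained) problem have equal optimal values. -/
theorem single_battery_constrained_eq_modified
    {Ω : Type*} {mΩ : MeasurableSpace Ω} (P : Measure Ω) [IsProbabilityMeasure P]
    (T : ℝ) (hT : 0 < T)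
    (𝓕 : Filtration ℝ mΩ)
    (p S : ℝ → Ω → ℝ)
    (hp_prog : ProgMeasurable 𝓕 p) (hS_prog : ProgMeasurable 𝓕 S)
    (hp_nonneg : ∀ t ω, 0 ≤ p t ω) (hS_nonneg : ∀ t ω, 0 ≤ S t ω)
    (hp_bdd : ∃ K : ℝ, ∀ t ω, p t ω ≤ K) (hS_bdd : ∃ K : ℝ, ∀ t ω, S t ω ≤ K)
    (L C : ℝ) (hL : 0 < L) (hC : 0 < C)
    (y0 : ℝ) (hy0 : y0 ∈ Set.Icc (0:ℝ) C) :
    sSup {v : ℝ | ∃ u : ℝ → Ω → ℝ,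
        -- u ∈ U
        (ProgMeasurable 𝓕 u ∧
          ∀ t ω, u t ω ∈ Set.Icc (-L) (min (p t ω) L)) ∧
        -- storage constraint: u ∈ U_C
        (∀ᵐ ω ∂P, ∀ s ∈ Set.Icc (0:ℝ) T,
          y0 + (∫ r in (0:ℝ)..s, u r ω) ∈ Set.Icc (0:ℝ) C) ∧
        -- value of the constrained problem
        v = ∫ ω, ((∫ t in (0:ℝ)..T, (p t ω - u t ω) * S t ω)
              + (y0 + ∫ r in (0:ℝ)..T, u r ω) * S T ω) ∂P}
      =
    sSup {v : ℝ | ∃ u : ℝ → Ω → ℝ, ∃ yhat : ℝ → Ω → ℝ,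
        -- u ∈ U
        (ProgMeasurable 𝓕 u ∧
          ∀ t ω, u t ω ∈ Set.Icc (-L) (min (p t ω) L)) ∧
        -- yhat is a continuous adapted process solving the truncated dynamics
        (∀ ω, Continuous fun s => yhat s ω) ∧
        Adapted 𝓕 yhat ∧
        (∀ᵐ ω ∂P, ∀ s ∈ Set.Icc (0:ℝ) T,
          yhat s ω = y0 + ∫ r in (0:ℝ)..s, (if yhat r ω ≤ C then u r ω else 0)) ∧
        -- value of the modified problem
        v = ∫ ω, ((∫ t in (0:ℝ)..T,
                (if 0 ≤ yhat t ω then (1:ℝ) else 0) * ((p t ω - u t ω) * S t ω))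
              + yhat T ω * S T ω) ∂P} := by
  obtain ⟨K, hK⟩ := hp_bdd
  obtain ⟨M, hM⟩ := hS_bdd
  have hT0 : (0 : ℝ) ≤ T := hT.le
  have hSabs (t : ℝ) (ω : Ω) : |S t ω| ≤ M := (abs_of_nonneg (hS_nonneg t ω)).trans_le (hM t ω)
  have huabs {u : ℝ → Ω → ℝ} (hu : ∀ t ω, u t ω ∈ Set.Icc (-L) (min (p t ω) L)) (t : ℝ) (ω : Ω) :
      |u t ω| ≤ L := abs_le.2 ⟨(hu t ω).1, (hu t ω).2.trans (min_le_right _ _)⟩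
  have hGnonneg {u : ℝ → Ω → ℝ} (hu : ∀ t ω, u t ω ∈ Set.Icc (-L) (min (p t ω) L)) (t : ℝ)
      (ω : Ω) : 0 ≤ (p t ω - u t ω) * S t ω :=
    mul_nonneg (sub_nonneg.2 ((hu t ω).2.trans (min_le_left _ _))) (hS_nonneg t ω)
  have hGabs {u : ℝ → Ω → ℝ} (hu : ∀ t ω, u t ω ∈ Set.Icc (-L) (min (p t ω) L)) (t : ℝ)
      (ω : Ω) : |(p t ω - u t ω) * S t ω| ≤ (K + L) * M := by
    rw [abs_of_nonneg (hGnonneg hu t ω)]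
    have h1 := (hu t ω).1
    have h2 := hK t ω
    have h3 := hp_nonneg t ω
    exact mul_le_mul (by linarith) (hM t ω) (hS_nonneg t ω) (by linarith)
  have hGprog {u : ℝ → Ω → ℝ} (hu : IsStronglyProgressive 𝓕 u) :
      IsStronglyProgressive 𝓕 fun t ω => (p t ω - u t ω) * S t ω :=
    fun i => ((hp_prog i).sub (hu i)).mul (hS_prog i)
  have hYcont {u : ℝ → Ω → ℝ} (hu : IsStronglyProgressive 𝓕 u)
      (huI : ∀ t ω, u t ω ∈ Set.Icc (-L) (min (p t ω) L)) (ω : Ω) :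
      Continuous fun s => y0 + ∫ r in (0 : ℝ)..max s 0, u r ω :=
    (lipschitzWith_integral_of_abs_le (hu.measurable_path ω) (fun t => huabs huI t ω)
      y0).continuous.comp (continuous_id.max continuous_const)
  refine csSup_eq_csSup_of_forall_exists_le ?_ ?_
  · rintro v ⟨u, ⟨hu, huI⟩, hconstr, rfl⟩
    refine ⟨_, ⟨u, fun s ω => y0 + ∫ r in (0 : ℝ)..max s 0, u r ω, ⟨hu, huI⟩,
      hYcont hu huI, hu.adapted_integral y0, ?_, rfl⟩, le_of_eq ?_⟩
    · filter_upwards [hconstr] with ω hω s hs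
      simp only [max_eq_left hs.1]
      congr 1
      refine intervalIntegral.integral_congr fun r hr => ?_
      rw [Set.uIcc_of_le hs.1] at hr
      simp only [max_eq_left hr.1]
      exact (if_pos (hω r ⟨hr.1, hr.2.trans hs.2⟩).2).symm
    · refine integral_congr_ae ?_
      filter_upwards [hconstr] with ω hω
      simp only [max_eq_left hT0]
      congr 1
      refine intervalIntegral.integral_congr fun t ht => ?_
      rw [Set.uIcc_of_le hT0] at ht
      simp only [max_eq_left ht.1]
      rw [if_pos (hω t ht).1, one_mul]
  · rintro v ⟨u, yhat, ⟨hu, huI⟩, hcont, -, hdyn, rfl⟩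
    set Y : ℝ → Ω → ℝ := fun s ω => y0 + ∫ r in (0 : ℝ)..max s 0, u r ω with hY
    have hYprog : IsStronglyProgressive 𝓕 Y :=
      (hu.adapted_integral y0).stronglyAdapted.isStronglyProgressive_of_continuous
        (hYcont hu huI)
    set w : ℝ → Ω → ℝ := fun t ω => if 0 ≤ Y t ω then u t ω else 0 with hw
    have hwprog : IsStronglyProgressive 𝓕 w := hYprog.ite_nonneg hu
    have hwI (t : ℝ) (ω : Ω) : w t ω ∈ Set.Icc (-L) (min (p t ω) L) := by
      simp only [hw]
      split_ifs
      · exact huI t ω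
      · exact ⟨by linarith, le_min (hp_nonneg t ω) hL.le⟩
    have hwint (ω : Ω) (s : ℝ) (hs : 0 ≤ s) :
        y0 + ∫ r in (0 : ℝ)..s, w r ω = max (y0 + ∫ r in (0 : ℝ)..s, u r ω) 0 := by
      rw [← integral_ite_nonneg_eq_max (hu.measurable_path ω) (fun t => huabs huI t ω) hy0.1 s]
      congr 1
      refine intervalIntegral.integral_congr fun r hr => ?_
      rw [Set.uIcc_of_le hs] at hr
      simp only [hw, hY, max_eq_left hr.1]
    have hyhat : ∀ᵐ ω ∂P, ∀ s ∈ Set.Icc (0 : ℝ) T,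
        yhat s ω ≤ C ∧ yhat s ω = y0 + ∫ r in (0 : ℝ)..s, u r ω := by
      filter_upwards [hdyn] with ω hω
      have hle : ∀ s ∈ Set.Icc (0 : ℝ) T, yhat s ω ≤ C := fun s hs =>
        le_of_eq_integral_truncated (hu.measurable_path ω) (fun t => huabs huI t ω) (hcont ω)
          hy0.2 hω hs
      refine fun s hs => ⟨hle s hs, ?_⟩
      rw [hω s hs]
      congr 1
      refine intervalIntegral.integral_congr fun r hr => ?_
      rw [Set.uIcc_of_le hs.1] at hr
      exact if_pos (hle r ⟨hr.1, hr.2.trans hs.2⟩)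
    refine ⟨_, ⟨w, ⟨hwprog, hwI⟩, ?_, rfl⟩, ?_⟩
    · filter_upwards [hyhat] with ω hω s hs
      rw [hwint ω s hs.1]
      have h := hω s hs
      exact ⟨le_max_right _ _, max_le (h.2 ▸ h.1) hC.le⟩
    · set G : ℝ → Ω → ℝ := fun t ω => if 0 ≤ Y t ω then (p t ω - u t ω) * S t ω else 0 with hG
      have hGp : IsStronglyProgressive 𝓕 G := hYprog.ite_nonneg (hGprog hu)
      have hGb (t : ℝ) (ω : Ω) : |G t ω| ≤ (K + L) * M := by
        simp only [hG]
        split_ifs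
        · exact hGabs huI t ω
        · simpa using (abs_nonneg _).trans (hGabs huI t ω)
      have hcongr : (fun ω => (∫ t in (0:ℝ)..T,
            (if 0 ≤ yhat t ω then (1:ℝ) else 0) * ((p t ω - u t ω) * S t ω)) + yhat T ω * S T ω)
          =ᵐ[P] fun ω => (∫ t in (0 : ℝ)..T, G t ω)
            + (y0 + ∫ r in (0 : ℝ)..T, u r ω) * S T ω := by
        filter_upwards [hyhat] with ω hω
        rw [(hω T ⟨hT0, le_rfl⟩).2]
        congr 1
        refine intervalIntegral.integral_congr fun t ht => ?_
        rw [Set.uIcc_of_le hT0] at ht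
        simp only [hG, hY, (hω t ht).2, max_eq_left ht.1, ite_mul, one_mul, zero_mul]
      rw [integral_congr_ae hcongr]
      refine integral_mono
        (integrable_running_add_terminal hGp hu hS_prog hT0 hGb (huabs huI) hSabs y0)
        (integrable_running_add_terminal (hGprog hwprog) hwprog hS_prog hT0 (hGabs hwI)
          (huabs hwI) hSabs y0) fun ω => ?_
      refine add_le_add (intervalIntegral.integral_mono_on hT0
        (intervalIntegrable_of_measurable_of_abs_le (hGp.measurable_path ω) (hGb · ω) 0 T)
        (intervalIntegrable_of_measurable_of_abs_le ((hGprog hwprog).measurable_path ω)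
          (hGabs hwI · ω) 0 T) fun t _ => ?_) ?_
      · by_cases h : 0 ≤ Y t ω
        · simp only [hG, hw, if_pos h, le_refl]
        · simpa only [hG, if_neg h] using hGnonneg hwI t ω
      · rw [hwint ω T hT0]
        exact mul_le_mul_of_nonneg_right (le_max_left _ _) (hS_nonneg T ω)
end

section
/- If y_0 ≤ C and y : [0,T] → ℝ is a continuous function satisfying the integral equation y(s) = y_0 + ∫_0^s u(r)·1{y(r) ≤ C} dr for all s ∈ [0,T], then y(s) ≤ C for every s ∈ [0,T]. In particular, the modified (capacity-truncated) storage dynamics never exceed the capacity level C. -/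
open MeasureTheory

/-- If `y₀ ≤ C` and a continuous `y` satisfies the capacity-truncated
integral dynamics `y s = y₀ + ∫_0^s u r · 1{y r ≤ C} dr` on `[0,T]`, then
`y s ≤ C` on `[0,T]`. -/
theorem capacity_truncated_dynamics_never_exceed_capacity
    (T C y0 : ℝ) (hT : 0 < T)
    (u : ℝ → ℝ) (hu : IntegrableOn u (Set.Icc 0 T))
    (y : ℝ → ℝ) (hy : ContinuousOn y (Set.Icc 0 T))
    (hy0 : y0 ≤ C)
    (heq : ∀ s ∈ Set.Icc (0:ℝ) T,
      y s = y0 + ∫ r in (0:ℝ)..s, (if y r ≤ C then u r else 0)) :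
    ∀ s ∈ Set.Icc (0:ℝ) T, y s ≤ C := by
  intro s hs
  by_contra! hlt
  have hclosed : ∀ b ≤ T, IsClosed (Set.Icc 0 b ∩ y ⁻¹' Set.Iic C) := fun b hb =>
    (hy.mono (Set.Icc_subset_Icc_right hb)).preimage_isClosed_of_isClosed isClosed_Icc isClosed_Iic
  have hint : IntegrableOn (fun r => if y r ≤ C then u r else 0) (Set.Icc 0 T) := by
    refine (hu.indicator (hclosed T le_rfl).measurableSet).congr_fun (fun r hr => ?_)
      measurableSet_Icc
    by_cases h : y r ≤ C <;> simp [Set.indicator, h, hr.1, hr.2]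
  have hzero : y 0 ≤ C := by
    rw [heq 0 ⟨le_rfl, hT.le⟩]
    simpa using hy0
  obtain ⟨t, ⟨ht, htC⟩, hmax⟩ :=
    (isCompact_Icc.of_isClosed_subset (hclosed s hs.2) Set.inter_subset_left).exists_isGreatest
      ⟨0, ⟨le_rfl, hs.1⟩, hzero⟩
  have htT : t ∈ Set.Icc 0 T := ⟨ht.1, ht.2.trans hs.2⟩
  have hinterval : ∀ a ∈ Set.Icc 0 T, ∀ b ∈ Set.Icc 0 T,
      IntervalIntegrable (fun r => if y r ≤ C then u r else 0) volume a b := fun a ha b hb =>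
    (hint.mono_set (Set.uIcc_subset_Icc ha hb)).intervalIntegrable
  have hvanish : ∫ r in t..s, (if y r ≤ C then u r else 0) = 0 := by
    rw [intervalIntegral.integral_of_le ht.2]
    refine setIntegral_eq_zero_of_forall_eq_zero fun r hr => if_neg fun h => ?_
    exact hr.1.not_ge (hmax ⟨⟨ht.1.trans hr.1.le, hr.2⟩, h⟩)
  have hadd := intervalIntegral.integral_add_adjacent_intervals
    (hinterval 0 ⟨le_rfl, hT.le⟩ t htT) (hinterval t htT s hs)
  have hst : y s = y t := by
    rw [heq s hs, heq t htT, ← hadd, hvanish, add_zero]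
  exact hlt.not_ge (hst.trans_le htC)
end

section
/- If, for some integer k ≥ 1, the k-fold iterated pathwise integral Y^{(k)} of u is adapted — i.e. for every t ∈ [0,T] the random variable ω ↦ Y^{(k)}(t, ω) is 𝓕_t-measurable, where Y^{(0)} = u and Y^{(j)}(t, ω) = ∫_0^t Y^{(j−1)}(s, ω) ds for j ≥ 1 — then u itself is adapted up to a null modification: for Lebesgue-almost every t ∈ [0,T], the random variable u(t, ·) agrees P-almost surely with an 𝓕_t-measurable random variable. -/
open MeasureTheory Filter Topology Set

/-- An almost everywhere limit of measurable functions is measurable with respect to a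
σ-algebra that contains all null sets. -/
lemma measurable_of_tendsto_ae_of_null_measurable {Ω E : Type*} {mΩ : MeasurableSpace Ω}
    {P : Measure Ω} [TopologicalSpace E] [TopologicalSpace.PseudoMetrizableSpace E]
    [MeasurableSpace E] [BorelSpace E] [Zero E] {m' : MeasurableSpace Ω}
    (hnull : ∀ N : Set Ω, P N = 0 → MeasurableSet[m'] N)
    {f : ℕ → Ω → E} {g : Ω → E} (hf : ∀ n, Measurable[m'] (f n))
    (hlim : ∀ᵐ ω ∂P, Tendsto (fun n => f n ω) atTop (𝓝 (g ω))) : Measurable[m'] g := by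
  set N : Set Ω := {ω | ¬ Tendsto (fun n => f n ω) atTop (𝓝 (g ω))}
  have hN0 : P N = 0 := ae_iff.1 hlim
  have hNm : MeasurableSet[m'] N := hnull N hN0
  have hv : Measurable[m'] (Nᶜ.indicator g) := by
    refine @measurable_of_tendsto_metrizable Ω E m' _ _ _ _ (fun n => Nᶜ.indicator (f n)) _
      (fun n => (hf n).indicator hNm.compl) (tendsto_pi_nhds.2 fun ω => ?_)
    by_cases hω : ω ∈ N
    · simp [hω, tendsto_const_nhds]
    · simpa [hω] using not_not.1 hω
  intro A hA
  have hA' : g ⁻¹' A = (Nᶜ.indicator g ⁻¹' A ∩ Nᶜ) ∪ (g ⁻¹' A ∩ N) := by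
    ext ω
    by_cases hω : ω ∈ N <;> simp [hω]
  rw [hA']
  exact ((hv hA).inter hNm.compl).union
    (hnull _ (measure_mono_null inter_subset_right hN0))

/-- The difference quotients at `t` with respect to the points `t - t / (n + 1)`
converge to the derivative. -/
lemma HasDerivAt.tendsto_slope_sub_div {E : Type*} [NormedAddCommGroup E] [NormedSpace ℝ E]
    {f : ℝ → E} {f' : E} {t : ℝ} (h : HasDerivAt f f' t) (ht : 0 < t) :
    Tendsto (fun n : ℕ => slope f t (t - t / (n + 1))) atTop (𝓝 f') := by
  refine (hasDerivAt_iff_tendsto_slope.1 h).comp (tendsto_nhdsWithin_iff.2 ⟨?_, ?_⟩)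
  · have := (tendsto_one_div_add_atTop_nhds_zero_nat (𝕜 := ℝ)).const_mul t
    simpa [div_eq_mul_inv] using this.const_sub t
  · refine Eventually.of_forall fun n => ?_
    have : 0 < t / ((n : ℝ) + 1) := by positivity
    simp only [mem_compl_iff, mem_singleton_iff]
    linarith

/-- If the left difference quotients at `t` of a process adapted on `[0, t]` converge almost surely,
then their limit is measurable at time `t`. -/
lemma measurable_of_ae_tendsto_slope {Ω E : Type*} {mΩ : MeasurableSpace Ω} {P : Measure Ω}
    [NormedAddCommGroup E] [NormedSpace ℝ E] [MeasurableSpace E] [BorelSpace E]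
    [SecondCountableTopology E] {𝓕 : Filtration ℝ mΩ}
    (hnull : ∀ t : ℝ, ∀ N : Set Ω, P N = 0 → MeasurableSet[𝓕 t] N)
    {Z : ℝ → Ω → E} {g : Ω → E} {t : ℝ} (ht : 0 < t)
    (hZ : ∀ s ∈ Icc 0 t, Measurable[𝓕 s] (Z s))
    (hlim : ∀ᵐ ω ∂P, Tendsto (fun n : ℕ => slope (fun s => Z s ω) t (t - t / (n + 1)))
      atTop (𝓝 (g ω))) : Measurable[𝓕 t] g := by
  refine measurable_of_tendsto_ae_of_null_measurable (hnull t) (fun n => ?_) hlim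
  have h0 : 0 < t / ((n : ℝ) + 1) := by positivity
  have h1 : t / ((n : ℝ) + 1) ≤ t := div_le_self ht.le (by linarith [n.cast_nonneg (α := ℝ)])
  have hs : Measurable[𝓕 t] (Z (t - t / (n + 1))) :=
    (hZ _ ⟨by linarith, by linarith⟩).mono (𝓕.mono (by linarith)) le_rfl
  simp only [slope, vsub_eq_sub]
  exact (hs.sub (hZ t ⟨ht.le, le_rfl⟩)).const_smul _

/-- The pathwise primitive of a jointly measurable process is jointly measurable. -/
lemma measurable_uncurry_primitive {Ω E : Type*} {mΩ : MeasurableSpace Ω}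
    [NormedAddCommGroup E] [NormedSpace ℝ E] [MeasurableSpace E] [BorelSpace E]
    [SecondCountableTopology E] {u : ℝ → Ω → E} (hu : Measurable (Function.uncurry u)) :
    Measurable (fun p : ℝ × Ω => ∫ s in (0 : ℝ)..p.1, u s p.2) := by
  have hu' : Measurable fun q : (ℝ × Ω) × ℝ => u q.2 q.1.2 :=
    hu.comp (measurable_snd.prodMk (measurable_snd.comp measurable_fst))
  have key : ∀ a b : ℝ × Ω → ℝ, Measurable a → Measurable b →
      Measurable fun p : ℝ × Ω => ∫ s in Ioc (a p) (b p), u s p.2 := by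
    intro a b ha hb
    have hS : MeasurableSet {q : (ℝ × Ω) × ℝ | q.2 ∈ Ioc (a q.1) (b q.1)} :=
      (measurableSet_lt (ha.comp measurable_fst) measurable_snd).inter
        (measurableSet_le measurable_snd (hb.comp measurable_fst))
    have := ((hu'.indicator hS).stronglyMeasurable.integral_prod_right' (ν := volume)).measurable
    convert this using 2 with p
    rw [← integral_indicator measurableSet_Ioc]
    rfl
  exact (key _ _ measurable_const measurable_fst).sub (key _ _ measurable_fst measurable_const)

/-- A jointly measurable square-integrable process has almost surely integrable paths. -/
lemma ae_integrableOn_path {Ω E : Type*} {mΩ : MeasurableSpace Ω} {P : Measure Ω}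
    [IsFiniteMeasure P] [NormedAddCommGroup E] [MeasurableSpace E] [BorelSpace E]
    [SecondCountableTopology E] {u : ℝ → Ω → E} (hu : Measurable (Function.uncurry u)) {T : ℝ}
    (hu_L2 : (∫⁻ t in Icc (0 : ℝ) T, ∫⁻ ω, (‖u t ω‖₊ : ENNReal) ^ 2 ∂P) < ⊤) :
    ∀ᵐ ω ∂P, IntegrableOn (fun t => u t ω) (Icc 0 T) := by
  have hint : Integrable (Function.uncurry u) ((volume.restrict (Icc 0 T)).prod P) := by
    have hL2 : MemLp (Function.uncurry u) 2 ((volume.restrict (Icc 0 T)).prod P) := by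
      refine ⟨hu.aestronglyMeasurable, ?_⟩
      rw [eLpNorm_lt_top_iff_lintegral_rpow_enorm_lt_top (by simp) (by simp)]
      have hm : Measurable fun z : ℝ × Ω => ‖Function.uncurry u z‖ₑ ^ (2 : ENNReal).toReal :=
        hu.enorm.pow_const _
      rw [lintegral_prod _ hm.aemeasurable]
      simpa [enorm_eq_nnnorm] using hu_L2
    exact hL2.integrable (by norm_num)
  exact hint.prod_left_ae

/-- The order of the two almost-everywhere quantifiers in front of a convergence statement for
jointly measurable functions can be exchanged. -/
lemma ae_ae_tendsto_comm {α β E : Type*} {mα : MeasurableSpace α} {mβ : MeasurableSpace β}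
    {μ : Measure α} {ν : Measure β} [SFinite μ] [SFinite ν] [PseudoMetricSpace E]
    [MeasurableSpace E] [BorelSpace E] [SecondCountableTopology E]
    {f : ℕ → α → β → E} {g : α → β → E} (hf : ∀ n, Measurable (Function.uncurry (f n)))
    (hg : Measurable (Function.uncurry g))
    (h : ∀ᵐ y ∂ν, ∀ᵐ x ∂μ, Tendsto (fun n => f n x y) atTop (𝓝 (g x y))) :
    ∀ᵐ x ∂μ, ∀ᵐ y ∂ν, Tendsto (fun n => f n x y) atTop (𝓝 (g x y)) := by
  refine (Measure.ae_ae_comm ?_).2 h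
  convert measurableSet_tendsto (𝓝 (0 : ℝ)) (l := atTop) fun n => (hf n).dist hg using 3
  exact tendsto_iff_dist_tendsto_zero

/-- If for some `k ≥ 1` the `k`-fold iterated pathwise integral of a
jointly measurable square-integrable process `u` is adapted to a filtration whose
σ-algebras contain all null sets, then `u` itself is adapted up to a null
modification. -/
theorem adapted_iterated_integral_implies_adapted
    {Ω : Type*} {mΩ : MeasurableSpace Ω} (P : Measure Ω) [IsProbabilityMeasure P]
    (T : ℝ) (hT : 0 < T)
    (𝓕 : Filtration ℝ mΩ)
    (hnull : ∀ t : ℝ, ∀ N : Set Ω, P N = 0 → MeasurableSet[𝓕 t] N)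
    (m : ℕ)
    (u : ℝ → Ω → EuclideanSpace ℝ (Fin m))
    (hu_meas : Measurable (Function.uncurry u))
    (hu_L2 : (∫⁻ t in Set.Icc (0:ℝ) T, ∫⁻ ω, (‖u t ω‖₊ : ENNReal) ^ 2 ∂P) < ⊤)
    (Y : ℕ → ℝ → Ω → EuclideanSpace ℝ (Fin m))
    (hY0 : Y 0 = u)
    (hYsucc : ∀ j t ω, Y (j + 1) t ω = ∫ s in (0:ℝ)..t, Y j s ω)
    (k : ℕ) (hk : 1 ≤ k)
    (hadapted : ∀ t ∈ Set.Icc (0:ℝ) T, Measurable[𝓕 t] (Y k t)) :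
    ∀ᵐ t ∂(volume.restrict (Set.Icc (0:ℝ) T)),
      ∃ v : Ω → EuclideanSpace ℝ (Fin m),
        Measurable[𝓕 t] v ∧ ∀ᵐ ω ∂P, u t ω = v ω := by
  have hpath := ae_integrableOn_path hu_meas hu_L2
  have hcont : ∀ ω, IntegrableOn (fun t => u t ω) (Icc 0 T) → ∀ j,
      IntegrableOn (fun t => Y j t ω) (Icc 0 T) ∧
        ContinuousOn (fun t => Y (j + 1) t ω) (Icc 0 T) := by
    intro ω hω j
    have step : ∀ i, IntegrableOn (fun t => Y i t ω) (Icc 0 T) →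
        ContinuousOn (fun t => Y (i + 1) t ω) (Icc 0 T) := by
      intro i hi
      simp only [hYsucc]
      rw [← uIcc_of_le hT.le] at hi ⊢
      exact intervalIntegral.continuousOn_primitive_interval hi
    induction j with
    | zero =>
      have h0 : IntegrableOn (fun t => Y 0 t ω) (Icc 0 T) := by rwa [hY0]
      exact ⟨h0, step 0 h0⟩
    | succ i ih =>
      have hi := ih.2.integrableOn_Icc (μ := volume)
      exact ⟨hi, step _ hi⟩
  have hdown : ∀ j, (∀ t ∈ Ico 0 T, Measurable[𝓕 t] (Y (j + 2) t)) →
      ∀ t ∈ Ico 0 T, Measurable[𝓕 t] (Y (j + 1) t) := by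
    intro j hj t ht
    rcases ht.1.eq_or_lt with rfl | ht0
    · have : Y (j + 1) 0 = fun _ => 0 := funext fun ω => by simp [hYsucc]
      rw [this]
      exact measurable_const
    refine measurable_of_ae_tendsto_slope hnull ht0
      (fun s hs => hj s ⟨hs.1, hs.2.trans_lt ht.2⟩) ?_
    filter_upwards [hpath] with ω hω
    refine HasDerivAt.tendsto_slope_sub_div ?_ ht0
    simp only [hYsucc (j + 1)]
    have hc := (hcont ω hω j).2
    have hnhds : Icc 0 T ∈ 𝓝 t := Icc_mem_nhds ht0 ht.2
    refine intervalIntegral.integral_hasDerivAt_right ?_ ?_ (hc.continuousAt hnhds)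
    · rw [intervalIntegrable_iff_integrableOn_Icc_of_le ht.1]
      exact (hcont ω hω (j + 1)).1.mono_set (Icc_subset_Icc_right ht.2.le)
    · exact ⟨Icc 0 T, hnhds, hc.aestronglyMeasurable measurableSet_Icc⟩
  have hY1 : ∀ t ∈ Ico 0 T, Measurable[𝓕 t] (Y 1 t) := by
    have hk' : ∀ t ∈ Ico 0 T, Measurable[𝓕 t] (Y k t) := fun t ht =>
      hadapted t (Ico_subset_Icc_self ht)
    clear hadapted
    induction k, hk using Nat.le_induction with
    | base => exact hk'
    | succ i hi ih =>
      obtain ⟨j, rfl⟩ := Nat.exists_eq_add_of_le' hi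
      exact ih (hdown j hk')
  have hYm : Measurable fun p : ℝ × Ω => Y 1 p.1 p.2 := by
    simp only [hYsucc, hY0]
    exact measurable_uncurry_primitive hu_meas
  have hderiv : ∀ᵐ ω ∂P, ∀ᵐ t ∂(volume.restrict (Icc (0 : ℝ) T)),
      Tendsto (fun n : ℕ => slope (fun s => Y 1 s ω) t (t - t / (n + 1))) atTop
        (𝓝 (u t ω)) := by
    filter_upwards [hpath] with ω hω
    have hi : IntervalIntegrable (fun t => u t ω) volume 0 T :=
      (intervalIntegrable_iff_integrableOn_Icc_of_le hT.le).2 hω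
    have h0 : ∀ᵐ t : ℝ, t ≠ 0 := by simp [ae_iff, measure_singleton]
    rw [ae_restrict_iff' measurableSet_Icc]
    filter_upwards [hi.ae_hasDerivAt_integral, h0] with t ht ht0 htm
    refine HasDerivAt.tendsto_slope_sub_div ?_ (htm.1.lt_of_ne' ht0)
    simp only [hYsucc, hY0]
    exact ht (by rwa [uIcc_of_le hT.le]) 0 left_mem_uIcc
  have hswap := ae_ae_tendsto_comm (fun n => ?_) hu_meas hderiv
  · have hT' : ∀ᵐ t ∂(volume.restrict (Icc (0 : ℝ) T)), t ≠ 0 ∧ t ≠ T :=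
      ae_restrict_of_ae (Eventually.and (by simp [ae_iff, measure_singleton])
        (by simp [ae_iff, measure_singleton]))
    filter_upwards [hswap, hT', ae_restrict_mem measurableSet_Icc] with t ht hne htm
    exact ⟨u t, measurable_of_ae_tendsto_slope hnull (htm.1.lt_of_ne' hne.1)
      (fun s hs => hY1 s ⟨hs.1, hs.2.trans_lt (htm.2.lt_of_ne hne.2)⟩) ht, ae_of_all _ fun _ => rfl⟩
  · have hs : Measurable fun p : ℝ × Ω => p.1 - p.1 / ((n : ℝ) + 1) := by fun_prop
    have hYs : Measurable fun p : ℝ × Ω => Y 1 (p.1 - p.1 / ((n : ℝ) + 1)) p.2 :=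
      hYm.comp (hs.prodMk measurable_snd)
    simp only [slope, vsub_eq_sub]
    exact (hs.sub measurable_fst).inv.smul (hYs.sub hYm)
end

section
/- For every integer k ≥ 0, E[∫_0^T ⟨μ^{(k)}(t), u(t)⟩ dt] = 0, where μ^{(0)}(t) = M(T) − M(t) and μ^{(j)}(t) = ∫_t^T μ^{(j−1)}(s) ds for j ≥ 1. That is, every iterated backward integral of a martingale increment has zero expected pairing with every adapted square-integrable control. -/
open MeasureTheory
open scoped RealInnerProductSpace

section SquareIntegrable

variable {α E : Type*} {mα : MeasurableSpace α} {ν : Measure α} [NormedAddCommGroup E]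

theorem memLp_two_iff_lintegral_enorm_sq_lt_top {f : α → E} (hf : AEStronglyMeasurable f ν) :
    MemLp f 2 ν ↔ ∫⁻ x, ‖f x‖ₑ ^ 2 ∂ν < ⊤ := by
  rw [MemLp, and_iff_right hf,
    eLpNorm_lt_top_iff_lintegral_rpow_enorm_lt_top (by norm_num) (by norm_num)]
  simp

theorem lintegral_sq_le_measure_univ_mul {f : α → ENNReal} (hf : AEMeasurable f ν) :
    (∫⁻ x, f x ∂ν) ^ 2 ≤ ν Set.univ * ∫⁻ x, f x ^ 2 ∂ν := by
  have h := ENNReal.lintegral_mul_le_Lp_mul_Lq ν Real.HolderConjugate.two_two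
    (f := fun _ => 1) aemeasurable_const hf
  simp only [Pi.mul_apply, one_mul, ENNReal.rpow_ofNat, one_pow, lintegral_one] at h
  calc (∫⁻ x, f x ∂ν) ^ 2
      ≤ (ν Set.univ ^ (1 / 2 : ℝ) * (∫⁻ x, f x ^ 2 ∂ν) ^ (1 / 2 : ℝ)) ^ 2 := by gcongr
    _ = ν Set.univ * ∫⁻ x, f x ^ 2 ∂ν := by
      rw [mul_pow, ← ENNReal.rpow_mul_natCast, ← ENNReal.rpow_mul_natCast]
      norm_num

theorem enorm_sub_sq_le (x y : E) : ‖x - y‖ₑ ^ 2 ≤ 2 * (‖x‖ₑ ^ 2 + ‖y‖ₑ ^ 2) := by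
  have h : ‖x - y‖₊ ^ 2 ≤ 2 * (‖x‖₊ ^ 2 + ‖y‖₊ ^ 2) :=
    (pow_le_pow_left' (nnnorm_sub_le x y) 2).trans add_sq_le
  simp only [enorm_eq_nnnorm]
  exact_mod_cast h

variable [InnerProductSpace ℝ E]

theorem MemLp.integrable_real_inner {f g : α → E} (hf : MemLp f 2 ν) (hg : MemLp g 2 ν) :
    Integrable (fun x => ⟪f x, g x⟫) ν :=
  (hf.norm.integrable_mul hg.norm).mono' (hf.1.inner hg.1)
    (ae_of_all _ fun x => norm_inner_le_norm (f x) (g x))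

theorem integral_inner_eq_zero_of_condExp_eq_zero [CompleteSpace E] {m : MeasurableSpace α}
    (hm : m ≤ mα) [SigmaFinite (ν.trim hm)] {f v : α → E} (hf : MemLp f 2 ν) (hf' : Integrable f ν)
    (h : ν[f | m] =ᵐ[ν] 0) (hv : MemLp v 2 ν) (hvm : StronglyMeasurable[m] v) :
    ∫ x, ⟪f x, v x⟫ ∂ν = 0 := by
  have key := condExp_bilin_of_stronglyMeasurable_right (innerSL ℝ : E →L[ℝ] E →L[ℝ] ℝ)
    (m := m) (μ := ν) (f := f) (g := v) hvm (MemLp.integrable_real_inner hf hv) hf'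
  calc ∫ x, ⟪f x, v x⟫ ∂ν = ∫ x, (ν[fun x => innerSL ℝ (f x) (v x) | m]) x ∂ν :=
        (integral_condExp hm).symm
    _ = ∫ _, (0 : ℝ) ∂ν := by
      refine integral_congr_ae ?_
      filter_upwards [key, h] with x hx h0
      rw [hx, h0]
      simp
    _ = 0 := integral_zero _ _

end SquareIntegrable

section Product

variable {α Ω E : Type*} {mα : MeasurableSpace α} {mΩ : MeasurableSpace Ω}
  {ν : Measure α} {P : Measure Ω} [SFinite P] [NormedAddCommGroup E]

theorem memLp_two_uncurry_of_lintegral_lt_top {f : α → Ω → E}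
    (hf : StronglyMeasurable (Function.uncurry f))
    (h : ∫⁻ t, ∫⁻ ω, ‖f t ω‖ₑ ^ 2 ∂P ∂ν < ⊤) : MemLp (Function.uncurry f) 2 (ν.prod P) := by
  rw [memLp_two_iff_lintegral_enorm_sq_lt_top hf.aestronglyMeasurable,
    lintegral_prod _ (hf.enorm.pow_const 2).aemeasurable]
  exact h

theorem memLp_two_uncurry_of_bound [IsFiniteMeasure ν] {f : α → Ω → E}
    (hf : StronglyMeasurable (Function.uncurry f)) {C : ENNReal} (hC : C ≠ ⊤)
    (h : ∀ᵐ t ∂ν, ∫⁻ ω, ‖f t ω‖ₑ ^ 2 ∂P ≤ C) : MemLp (Function.uncurry f) 2 (ν.prod P) := by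
  refine memLp_two_uncurry_of_lintegral_lt_top hf ((lintegral_mono_ae h).trans_lt ?_)
  rw [lintegral_const]
  exact ENNReal.mul_lt_top hC.lt_top (measure_lt_top _ _)

theorem integral_integral_inner_eq_zero [SFinite ν] [InnerProductSpace ℝ E] {f g : α → Ω → E}
    (hf : MemLp (Function.uncurry f) 2 (ν.prod P)) (hg : MemLp (Function.uncurry g) 2 (ν.prod P))
    (h : ∀ᵐ t ∂ν, ∫ ω, ⟪f t ω, g t ω⟫ ∂P = 0) :
    ∫ ω, ∫ t, ⟪f t ω, g t ω⟫ ∂ν ∂P = 0 := by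
  have hfg : Integrable (Function.uncurry fun t ω => ⟪f t ω, g t ω⟫) (ν.prod P) :=
    MemLp.integrable_real_inner hf hg
  rw [← integral_integral_swap hfg, integral_congr_ae h, integral_zero]

end Product

section BackwardIntegral

variable {Ω E : Type*} {mΩ : MeasurableSpace Ω} {P : Measure Ω}
  [NormedAddCommGroup E] [NormedSpace ℝ E] {T : ℝ} {f : ℝ → Ω → E}

theorem stronglyMeasurable_uncurry_intervalIntegral_left
    (hf : StronglyMeasurable (Function.uncurry f)) :
    StronglyMeasurable (Function.uncurry fun t ω => ∫ s in t..T, f s ω) := by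
  have hfs : StronglyMeasurable fun q : (ℝ × Ω) × ℝ => f q.2 q.1.2 :=
    hf.comp_measurable (g := fun q : (ℝ × Ω) × ℝ => (q.2, q.1.2)) (by fun_prop)
  have h₁ : MeasurableSet {q : (ℝ × Ω) × ℝ | q.2 ∈ Set.Ioc q.1.1 T} := by
    simp only [Set.mem_Ioc]
    measurability
  have h₂ : MeasurableSet {q : (ℝ × Ω) × ℝ | q.2 ∈ Set.Ioc T q.1.1} := by
    simp only [Set.mem_Ioc]
    measurability
  convert ((hfs.indicator h₁).integral_prod_right' (ν := volume)).sub
    ((hfs.indicator h₂).integral_prod_right' (ν := volume)) using 1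
  ext p
  simp only [Function.uncurry, intervalIntegral, Pi.sub_apply,
    ← integral_indicator measurableSet_Ioc]
  rfl

theorem lintegral_enorm_intervalIntegral_sq_le [SFinite P]
    (hf : StronglyMeasurable (Function.uncurry f)) {C : ENNReal}
    (h : ∀ s ∈ Set.Icc 0 T, ∫⁻ ω, ‖f s ω‖ₑ ^ 2 ∂P ≤ C) {t : ℝ} (ht : t ∈ Set.Icc 0 T) :
    ∫⁻ ω, ‖∫ s in t..T, f s ω‖ₑ ^ 2 ∂P ≤ ENNReal.ofReal T * (C * ENNReal.ofReal T) := by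
  set ν := volume.restrict (Set.Ioc 0 T)
  have hν : ν Set.univ = ENNReal.ofReal T := by simp [ν]
  have hsq : Measurable fun p : ℝ × Ω => ‖f p.1 p.2‖ₑ ^ 2 := hf.enorm.pow_const 2
  calc ∫⁻ ω, ‖∫ s in t..T, f s ω‖ₑ ^ 2 ∂P
      ≤ ∫⁻ ω, ENNReal.ofReal T * ∫⁻ s, ‖f s ω‖ₑ ^ 2 ∂ν ∂P := by
        refine lintegral_mono fun ω => ?_
        have hω : StronglyMeasurable fun s => f s ω :=
          hf.comp_measurable measurable_prodMk_right
        rw [← hν]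
        refine le_trans ?_ (lintegral_sq_le_measure_univ_mul hω.enorm.aemeasurable)
        gcongr
        rw [intervalIntegral.integral_of_le ht.2]
        exact (enorm_integral_le_lintegral_enorm _).trans
          (lintegral_mono_set (Set.Ioc_subset_Ioc_left ht.1))
    _ = ENNReal.ofReal T * ∫⁻ s, ∫⁻ ω, ‖f s ω‖ₑ ^ 2 ∂P ∂ν := by
        rw [lintegral_const_mul _ hsq.lintegral_prod_left',
          ← lintegral_lintegral_swap (f := fun s ω => ‖f s ω‖ₑ ^ 2) hsq.aemeasurable]
    _ ≤ ENNReal.ofReal T * ∫⁻ _, C ∂ν := by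
        gcongr ENNReal.ofReal T * ?_
        exact setLIntegral_mono measurable_const fun s hs => h s (Set.Ioc_subset_Icc_self hs)
    _ = ENNReal.ofReal T * (C * ENNReal.ofReal T) := by rw [lintegral_const, hν]

end BackwardIntegral

theorem integral_inner_intervalIntegral_eq_zero {Ω E : Type*} {mΩ : MeasurableSpace Ω}
    {P : Measure Ω} [IsFiniteMeasure P] [NormedAddCommGroup E] [InnerProductSpace ℝ E]
    [CompleteSpace E]
    {T t : ℝ} {f : ℝ → Ω → E} {v : Ω → E} (htT : t ≤ T)
    (hf : MemLp (Function.uncurry f) 2 ((volume.restrict (Set.Ioc t T)).prod P))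
    (hv : MemLp v 2 P) (h : ∀ s ∈ Set.Ioc t T, ∫ ω, ⟪f s ω, v ω⟫ ∂P = 0) :
    ∫ ω, ⟪∫ s in t..T, f s ω, v ω⟫ ∂P = 0 := by
  set ν := volume.restrict (Set.Ioc t T)
  rw [← integral_integral_inner_eq_zero (ν := ν) (g := fun _ => v) hf (hv.comp_snd ν)
    (ae_restrict_of_forall_mem measurableSet_Ioc h)]
  refine integral_congr_ae ?_
  filter_upwards [(hf.integrable one_le_two).prod_left_ae] with ω hω
  simp_rw [intervalIntegral.integral_of_le htT, real_inner_comm (v ω)]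
  exact (integral_inner hω (v ω)).symm

/-- Every iterated backward integral `μ⁽ᵏ⁾` of the martingale
increment `μ⁽⁰⁾(t) = M(T) − M(t)` has zero expected pairing with every adapted
square-integrable control: `E ∫_0^T ⟨μ⁽ᵏ⁾(t), u(t)⟩ dt = 0` for all `k ≥ 0`. -/
theorem iterated_backward_martingale_increment_pairing_vanishes
    {Ω : Type*} {mΩ : MeasurableSpace Ω} (P : Measure Ω) [IsProbabilityMeasure P]
    (T : ℝ) (hT : 0 < T)
    (𝓕 : Filtration ℝ mΩ)
    (m : ℕ)
    (M : ℝ → Ω → EuclideanSpace ℝ (Fin m))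
    (hM : Martingale M 𝓕 P)
    (hM_meas : Measurable (Function.uncurry M))
    (hM_L2 : ∃ K : ℝ, ∀ t ∈ Set.Icc (0:ℝ) T,
      (∫⁻ ω, (‖M t ω‖₊ : ENNReal) ^ 2 ∂P) ≤ ENNReal.ofReal K)
    (u : ℝ → Ω → EuclideanSpace ℝ (Fin m))
    (hu_meas : Measurable (Function.uncurry u))
    (hu_adapted : ∀ t : ℝ, Measurable[𝓕 t] (u t))
    (hu_L2 : (∫⁻ t in Set.Icc (0:ℝ) T, ∫⁻ ω, (‖u t ω‖₊ : ENNReal) ^ 2 ∂P) < ⊤)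
    (μ : ℕ → ℝ → Ω → EuclideanSpace ℝ (Fin m))
    (hμ0 : ∀ t ω, μ 0 t ω = M T ω - M t ω)
    (hμsucc : ∀ j t ω, μ (j + 1) t ω = ∫ s in t..T, μ j s ω) :
    ∀ k : ℕ, ∫ ω, (∫ t in (0:ℝ)..T, ⟪μ k t ω, u t ω⟫) ∂P = 0 := by
  have hFm : ∀ k, StronglyMeasurable (Function.uncurry (μ k)) := by
    intro k
    induction k with
    | zero =>
      simp only [Function.uncurry_def, hμ0]
      exact ((hM_meas.comp (by fun_prop : Measurable fun p : ℝ × Ω => (T, p.2))).sub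
        hM_meas).stronglyMeasurable
    | succ k ih =>
      rw [show μ (k + 1) = fun t ω => ∫ s in t..T, μ k s ω from
        funext fun t => funext fun ω => hμsucc k t ω]
      exact stronglyMeasurable_uncurry_intervalIntegral_left ih
  have hbound : ∀ k, ∃ C : ENNReal, C ≠ ⊤ ∧
      ∀ t ∈ Set.Icc (0 : ℝ) T, ∫⁻ ω, ‖μ k t ω‖ₑ ^ 2 ∂P ≤ C := by
    intro k
    induction k with
    | zero =>
      obtain ⟨K, hK⟩ := hM_L2
      refine ⟨2 * (ENNReal.ofReal K + ENNReal.ofReal K), by finiteness, fun t ht => ?_⟩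
      have hMT : Measurable fun ω => ‖M T ω‖ₑ ^ 2 :=
        (hM_meas.comp measurable_prodMk_left).enorm.pow_const 2
      simp_rw [hμ0]
      refine (lintegral_mono fun ω => enorm_sub_sq_le (M T ω) (M t ω)).trans ?_
      rw [lintegral_const_mul' _ _ (by norm_num), lintegral_add_left hMT]
      gcongr
      · exact hK T ⟨hT.le, le_rfl⟩
      · exact hK t ht
    | succ k ih =>
      obtain ⟨C, hC, h⟩ := ih
      refine ⟨ENNReal.ofReal T * (C * ENNReal.ofReal T), by finiteness, fun t ht => ?_⟩
      simp_rw [hμsucc]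
      exact lintegral_enorm_intervalIntegral_sq_le (hFm k) h ht
  have hLp : ∀ k, ∀ t ∈ Set.Icc (0 : ℝ) T, MemLp (μ k t) 2 P := by
    intro k t ht
    obtain ⟨C, hC, h⟩ := hbound k
    exact (memLp_two_iff_lintegral_enorm_sq_lt_top
      ((hFm k).comp_measurable measurable_prodMk_left).aestronglyMeasurable).2
      ((h t ht).trans_lt hC.lt_top)
  have hLp_prod : ∀ k, ∀ t ∈ Set.Icc (0 : ℝ) T,
      MemLp (Function.uncurry (μ k)) 2 ((volume.restrict (Set.Ioc t T)).prod P) := by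
    intro k t ht
    obtain ⟨C, hC, h⟩ := hbound k
    exact memLp_two_uncurry_of_bound (hFm k) hC (ae_restrict_of_forall_mem measurableSet_Ioc
      fun s hs => h s ⟨ht.1.trans hs.1.le, hs.2⟩)
  have hortho : ∀ k, ∀ t ∈ Set.Icc (0 : ℝ) T, ∀ v : Ω → EuclideanSpace ℝ (Fin m),
      Measurable[𝓕 t] v → MemLp v 2 P → ∫ ω, ⟪μ k t ω, v ω⟫ ∂P = 0 := by
    intro k
    induction k with
    | zero =>
      intro t ht v hvm hv
      have hcond : P[μ 0 t | 𝓕 t] =ᵐ[P] 0 := by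
        rw [show μ 0 t = M T - M t from funext (hμ0 t)]
        filter_upwards [condExp_sub (hM.integrable T) (hM.integrable t) (𝓕 t),
          hM.condExp_ae_eq ht.2, hM.condExp_ae_eq (le_refl t)] with ω h₁ h₂ h₃
        rw [h₁, Pi.sub_apply, h₂, h₃, sub_self, Pi.zero_apply]
      exact integral_inner_eq_zero_of_condExp_eq_zero (𝓕.le t) (hLp 0 t ht)
        ((hLp 0 t ht).integrable one_le_two) hcond hv hvm.stronglyMeasurable
    | succ k ih =>
      intro t ht v hvm hv
      simp_rw [hμsucc]
      exact integral_inner_intervalIntegral_eq_zero ht.2 (hLp_prod k t ht) hv fun s hs =>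
        ih s ⟨ht.1.trans hs.1.le, hs.2⟩ v (hvm.mono (𝓕.mono hs.1.le) le_rfl) hv
  intro k
  have h0 : (0 : ℝ) ∈ Set.Icc 0 T := ⟨le_rfl, hT.le⟩
  rw [← restrict_Ioc_eq_restrict_Icc] at hu_L2
  have hu_sq : Measurable fun t => ∫⁻ ω, ‖u t ω‖ₑ ^ 2 ∂P :=
    (hu_meas.enorm.pow_const 2).lintegral_prod_right'
  simp_rw [intervalIntegral.integral_of_le hT.le]
  refine integral_integral_inner_eq_zero (hLp_prod k 0 h0)
    (memLp_two_uncurry_of_lintegral_lt_top hu_meas.stronglyMeasurable hu_L2) ?_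
  filter_upwards [ae_lt_top hu_sq hu_L2.ne, ae_restrict_mem measurableSet_Ioc] with t hut ht
  exact hortho k t (Set.Ioc_subset_Icc_self ht) (u t) (hu_adapted t)
    ((memLp_two_iff_lintegral_enorm_sq_lt_top
      (hu_meas.comp measurable_prodMk_left).aestronglyMeasurable).2 hut)
end

section
/- The Lagrangian duality for the subspace-constrained concave maximization problem holds without a duality gap: sup_{u ∈ Ū ∩ X} G(u) = sup_{u ∈ Ū} inf_{w ∈ X^⊥} (G(u) + ⟨w, u⟩) = inf_{w ∈ X^⊥} sup_{u ∈ Ū} (G(u) + ⟨w, u⟩), where all values are taken in the extended real numbers. -/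
open scoped RealInnerProductSpace

/-- A decreasing sequence of nonempty, closed, convex, bounded subsets of a Hilbert space has a
common point. -/
theorem exists_forall_mem_of_antitone_convex_isClosed
    {H : Type*} [NormedAddCommGroup H] [InnerProductSpace ℝ H] [CompleteSpace H]
    {K : ℕ → Set H} (hK : Antitone K) (hne : ∀ n, (K n).Nonempty)
    (hconv : ∀ n, Convex ℝ (K n)) (hclosed : ∀ n, IsClosed (K n))
    (hbdd : Bornology.IsBounded (K 0)) : ∃ x, ∀ n, x ∈ K n := by
  have hmin : ∀ n, ∃ x ∈ K n, ∀ y ∈ K n, ‖x‖ ≤ ‖y‖ := by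
    intro n
    obtain ⟨x, hx, hxe⟩ := exists_norm_eq_iInf_of_complete_convex (hne n)
      (hclosed n).isComplete (hconv n) 0
    refine ⟨x, hx, fun y hy => ?_⟩
    have h := ciInf_le (f := fun w : K n => ‖(0 : H) - w‖)
      ⟨0, by rintro _ ⟨w, rfl⟩; positivity⟩ ⟨y, hy⟩
    rw [← hxe] at h
    simpa using h
  choose x hx hxmin using hmin
  obtain ⟨C, hC⟩ := hbdd.exists_norm_le
  have hmono : Monotone fun n => ‖x n‖ ^ 2 := fun m n hmn =>
    pow_le_pow_left₀ (norm_nonneg _) (hxmin m _ (hK hmn (hx n))) 2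
  have hbound : BddAbove (Set.range fun n => ‖x n‖ ^ 2) := by
    refine ⟨C ^ 2, ?_⟩
    rintro _ ⟨n, rfl⟩
    exact pow_le_pow_left₀ (norm_nonneg _) (hC _ (hK (Nat.zero_le n) (hx n))) 2
  have hsq : ∀ m n, m ≤ n → ‖x n - x m‖ ^ 2 ≤ 2 * (‖x n‖ ^ 2 - ‖x m‖ ^ 2) := by
    intro m n hmn
    have hmid : (2⁻¹ : ℝ) • x n + (2⁻¹ : ℝ) • x m ∈ K m :=
      hconv m (hK hmn (hx n)) (hx m) (by norm_num) (by norm_num) (by norm_num)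
    have h := hxmin m _ hmid
    rw [← smul_add, norm_smul, Real.norm_of_nonneg (by norm_num)] at h
    have hpar := parallelogram_law_with_norm ℝ (x n) (x m)
    nlinarith [norm_nonneg (x m), norm_nonneg (x n + x m)]
  have hcauchy : CauchySeq x := by
    have hc := (tendsto_atTop_ciSup hmono hbound).cauchySeq
    rw [Metric.cauchySeq_iff'] at hc ⊢
    intro ε hε
    obtain ⟨N, hN⟩ := hc (ε ^ 2 / 2) (by positivity)
    refine ⟨N, fun n hn => ?_⟩
    have h1 := hN n hn
    rw [Real.dist_eq] at h1
    have h2 := hsq N n hn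
    rw [dist_eq_norm]
    refine lt_of_pow_lt_pow_left₀ 2 hε.le ?_
    linarith [le_abs_self (‖x n‖ ^ 2 - ‖x N‖ ^ 2)]
  obtain ⟨y, hy⟩ := cauchySeq_tendsto_of_complete hcauchy
  refine ⟨y, fun n => (hclosed n).mem_of_tendsto hy ?_⟩
  filter_upwards [Filter.eventually_ge_atTop n] with m hm using hK hm (hx m)

/-- The superlevel sets of a function continuous on a closed set are closed. -/
theorem ContinuousOn.isClosed_superlevel {α : Type*} [TopologicalSpace α] {U : Set α}
    (hU : IsClosed U) {G : α → ℝ} (hG : ContinuousOn G U) (r : ℝ) :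
    IsClosed {u ∈ U | r ≤ G u} :=
  hG.preimage_isClosed_of_isClosed hU isClosed_Ici

/-- A continuous concave function on a closed, bounded, convex subset of a Hilbert space is bounded
above. -/
theorem ConcaveOn.bddAbove_image_of_continuousOn
    {H : Type*} [NormedAddCommGroup H] [InnerProductSpace ℝ H] [CompleteSpace H]
    {U : Set H} (hU_closed : IsClosed U) (hU_bdd : Bornology.IsBounded U)
    {G : H → ℝ} (hG_conc : ConcaveOn ℝ U G) (hG_cont : ContinuousOn G U) :
    BddAbove (G '' U) := by
  by_contra hunb
  obtain ⟨x, hx⟩ := exists_forall_mem_of_antitone_convex_isClosed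
    (K := fun n : ℕ => {u ∈ U | (n : ℝ) ≤ G u})
    (fun m n hmn u hu => ⟨hu.1, (Nat.cast_le.2 hmn).trans hu.2⟩)
    (fun n => by
      obtain ⟨_, ⟨u, hu, rfl⟩, hlt⟩ := not_bddAbove_iff.1 hunb n
      exact ⟨u, hu, hlt.le⟩)
    (fun n => hG_conc.convex_ge n)
    (fun n => hG_cont.isClosed_superlevel hU_closed n)
    (hU_bdd.subset fun u hu => hu.1)
  obtain ⟨n, hn⟩ := exists_nat_gt (G x)
  exact absurd (hx n).2 hn.not_ge

/-- If a continuous concave function on a closed, bounded, convex set stays below `c` on the closed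
subspace `X`, then the image of its hypograph in `Xᗮ × ℝ` stays away from `(0, c)`. -/
theorem ConcaveOn.notMem_closure_image_hypograph
    {H : Type*} [NormedAddCommGroup H] [InnerProductSpace ℝ H] [CompleteSpace H]
    {X : Submodule ℝ H} (hX : IsClosed (X : Set H))
    {U : Set H} (hU_closed : IsClosed U) (hU_bdd : Bornology.IsBounded U)
    {G : H → ℝ} (hG_conc : ConcaveOn ℝ U G) (hG_cont : ContinuousOn G U)
    {c : ℝ} (hc : ∀ u ∈ U, u ∈ X → G u < c) :
    ((0 : Xᗮ), c) ∉ closure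
      (Prod.map Xᗮ.orthogonalProjectionOnto id '' {p : H × ℝ | p.1 ∈ U ∧ p.2 ≤ G p.1}) := by
  intro hmem
  rw [Metric.mem_closure_iff] at hmem
  let ε : ℕ → ℝ := fun n => 1 / ((n : ℝ) + 1)
  have hε : Antitone ε := fun m n hmn => Nat.one_div_le_one_div hmn
  have hε0 : Filter.Tendsto ε Filter.atTop (nhds 0) := tendsto_one_div_add_atTop_nhds_zero_nat
  obtain ⟨x, hx⟩ := exists_forall_mem_of_antitone_convex_isClosed
    (K := fun n : ℕ => {u ∈ U | c - ε n ≤ G u} ∩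
      Xᗮ.orthogonalProjectionOnto ⁻¹' Metric.closedBall 0 (ε n))
    (fun m n hmn u hu => ⟨⟨hu.1.1, (sub_le_sub_left (hε hmn) c).trans hu.1.2⟩,
      Metric.closedBall_subset_closedBall (hε hmn) hu.2⟩)
    (fun n => by
      obtain ⟨_, ⟨⟨u, t⟩, ⟨hu, ht⟩, rfl⟩, hd⟩ := hmem (ε n) Nat.one_div_pos_of_nat
      rw [Prod.dist_eq, max_lt_iff] at hd
      refine ⟨u, ⟨hu, ?_⟩, ?_⟩
      · have h := (abs_lt.1 (Real.dist_eq _ _ ▸ hd.2)).2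
        simp only [Prod.map_snd, id_eq] at h ht
        linarith
      · rw [Set.mem_preimage, Metric.mem_closedBall, dist_comm]
        exact hd.1.le)
    (fun n => (hG_conc.convex_ge _).inter
      ((convex_closedBall _ _).linear_preimage Xᗮ.orthogonalProjectionOnto.toLinearMap))
    (fun n => (hG_cont.isClosed_superlevel hU_closed _).inter
      (Metric.isClosed_closedBall.preimage Xᗮ.orthogonalProjectionOnto.continuous))
    (hU_bdd.subset fun u hu => hu.1.1)
  have hPx : Xᗮ.orthogonalProjectionOnto x = 0 := by
    rw [← norm_le_zero_iff]
    exact ge_of_tendsto' hε0 fun n => by simpa using (hx n).2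
  have hxX : x ∈ X := by
    rw [Submodule.orthogonalProjectionOnto_eq_zero_iff,
      Submodule.orthogonal_orthogonal_eq_closure, hX.submodule_topologicalClosure_eq] at hPx
    exact hPx
  have hcx : c ≤ G x := by
    have hlim := hε0.const_sub c
    rw [sub_zero] at hlim
    exact le_of_tendsto' hlim fun n => (hx n).1.2
  exact (hc x (hx 0).1.1 hxX).not_ge hcx

/-- If a continuous concave function on a nonempty, closed, bounded, convex set stays below `c` on
the closed subspace `X`, then some Lagrange multiplier in `Xᗮ` certifies the bound `c`. -/
theorem ConcaveOn.exists_multiplier_mem_orthogonal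
    {H : Type*} [NormedAddCommGroup H] [InnerProductSpace ℝ H] [CompleteSpace H]
    {X : Submodule ℝ H} (hX : IsClosed (X : Set H))
    {U : Set H} (hU_ne : U.Nonempty) (hU_closed : IsClosed U) (hU_bdd : Bornology.IsBounded U)
    {G : H → ℝ} (hG_conc : ConcaveOn ℝ U G) (hG_cont : ContinuousOn G U)
    {c : ℝ} (hc : ∀ u ∈ U, u ∈ X → G u < c) :
    ∃ w ∈ Xᗮ, ∀ u ∈ U, G u + ⟪w, u⟫ ≤ c := by
  have hconv : Convex ℝ
      (Prod.map Xᗮ.orthogonalProjectionOnto id '' {p : H × ℝ | p.1 ∈ U ∧ p.2 ≤ G p.1}) :=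
    hG_conc.convex_hypograph.linear_image
      (Xᗮ.orthogonalProjectionOnto.toLinearMap.prodMap LinearMap.id)
  obtain ⟨f, r, hfr, hr⟩ := geometric_hahn_banach_closed_point hconv.closure isClosed_closure
    (hG_conc.notMem_closure_image_hypograph hX hU_closed hU_bdd hG_cont hc)
  let v : Xᗮ := (InnerProductSpace.toDual ℝ Xᗮ).symm (f.comp (.inl ℝ Xᗮ ℝ))
  let l : ℝ := f (0, 1)
  have hf : ∀ (u : H) (t : ℝ), f (Xᗮ.orthogonalProjectionOnto u, t) = ⟪(v : H), u⟫ + l * t := by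
    intro u t
    have h1 : f (Xᗮ.orthogonalProjectionOnto u, 0) = ⟪(v : H), u⟫ :=
      InnerProductSpace.toDual_symm_apply.symm.trans
        (Submodule.inner_orthogonalProjectionOnto_eq_of_mem_left v u)
    have h2 : (Xᗮ.orthogonalProjectionOnto u, t) =
        (Xᗮ.orthogonalProjectionOnto u, (0 : ℝ)) + t • ((0 : Xᗮ), (1 : ℝ)) := by simp
    rw [h2, map_add, map_smul, h1, smul_eq_mul, mul_comm]
  have hlt : ∀ u ∈ U, ∀ t ≤ G u, ⟪(v : H), u⟫ + l * t < r := fun u hu t ht => by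
    rw [← hf]
    exact hfr _ (subset_closure ⟨(u, t), ⟨hu, ht⟩, rfl⟩)
  have hrc : r < l * c := by simpa using hr.trans_eq (by simpa using hf 0 c)
  have hl : 0 ≤ l := by
    by_contra! hl
    obtain ⟨u, hu⟩ := hU_ne
    have h := hlt u hu (min (G u) ((r - ⟪(v : H), u⟫) / l)) (min_le_left _ _)
    have h' := mul_le_mul_of_nonpos_left (min_le_right (G u) ((r - ⟪(v : H), u⟫) / l)) hl.le
    rw [mul_div_cancel₀ _ hl.ne] at h'
    linarith
  rcases hl.eq_or_lt with hl | hl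
  · rw [← hl, zero_mul] at hrc
    obtain ⟨M, hM⟩ := hG_conc.bddAbove_image_of_continuousOn hU_closed hU_bdd hG_cont
    refine ⟨(|M - c| / -r) • (v : H), Xᗮ.smul_mem _ v.2, fun u hu => ?_⟩
    have h := hlt u hu _ le_rfl
    rw [← hl, zero_mul, add_zero] at h
    have hk : 0 ≤ |M - c| / -r := div_nonneg (abs_nonneg _) (by linarith)
    have h1 := mul_le_mul_of_nonneg_left h.le hk
    have h2 : |M - c| / -r * r = -|M - c| := by
      have := hrc.ne
      field_simp
    rw [real_inner_smul_left]
    linarith [hM (Set.mem_image_of_mem G hu), le_abs_self (M - c)]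
  · refine ⟨l⁻¹ • (v : H), Xᗮ.smul_mem _ v.2, fun u hu => ?_⟩
    have h := ((hlt u hu _ le_rfl).trans hrc).le
    rw [real_inner_smul_left]
    refine le_of_mul_le_mul_left ?_ hl
    rw [mul_add, mul_inv_cancel_left₀ hl.ne']
    linarith

/-- No duality gap for the subspace-constrained concave maximization
problem over a nonempty convex closed bounded set `Ū` in a real Hilbert space:
`sup_{u ∈ Ū ∩ X} G(u) = sup_{u ∈ Ū} inf_{w ∈ Xᗮ} (G(u) + ⟪w, u⟫)
 = inf_{w ∈ Xᗮ} sup_{u ∈ Ū} (G(u) + ⟪w, u⟫)` in the extended reals. -/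
theorem subspace_lagrangian_no_duality_gap
    {H : Type*} [NormedAddCommGroup H] [InnerProductSpace ℝ H] [CompleteSpace H]
    (X : Submodule ℝ H) (hX : IsClosed (X : Set H))
    (U : Set H) (hU_ne : U.Nonempty) (hU_conv : Convex ℝ U)
    (hU_closed : IsClosed U) (hU_bdd : Bornology.IsBounded U)
    (G : H → ℝ) (hG_conc : ConcaveOn ℝ U G) (hG_cont : ContinuousOn G U) :
    (⨆ u ∈ U ∩ (X : Set H), ((G u : ℝ) : EReal))
        = (⨆ u ∈ U, ⨅ w ∈ Xᗮ, ((G u + ⟪w, u⟫ : ℝ) : EReal)) ∧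
    (⨆ u ∈ U, ⨅ w ∈ Xᗮ, ((G u + ⟪w, u⟫ : ℝ) : EReal))
        = (⨅ w ∈ Xᗮ, ⨆ u ∈ U, ((G u + ⟪w, u⟫ : ℝ) : EReal)) := by
  have h12 : (⨆ u ∈ U ∩ (X : Set H), ((G u : ℝ) : EReal))
      ≤ ⨆ u ∈ U, ⨅ w ∈ Xᗮ, ((G u + ⟪w, u⟫ : ℝ) : EReal) := by
    refine iSup₂_le fun u hu => le_iSup₂_of_le u hu.1 (le_iInf₂ fun w hw => ?_)
    rw [Submodule.inner_left_of_mem_orthogonal hu.2 hw, add_zero]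
  have h23 : (⨆ u ∈ U, ⨅ w ∈ Xᗮ, ((G u + ⟪w, u⟫ : ℝ) : EReal))
      ≤ ⨅ w ∈ Xᗮ, ⨆ u ∈ U, ((G u + ⟪w, u⟫ : ℝ) : EReal) :=
    iSup₂_le fun u hu => le_iInf₂ fun w hw =>
      (iInf₂_le w hw).trans (le_iSup₂_of_le u hu le_rfl)
  have h31 : (⨅ w ∈ Xᗮ, ⨆ u ∈ U, ((G u + ⟪w, u⟫ : ℝ) : EReal))
      ≤ ⨆ u ∈ U ∩ (X : Set H), ((G u : ℝ) : EReal) := by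
    by_contra! hlt
    obtain ⟨c, hc1, hc2⟩ := EReal.lt_iff_exists_real_btwn.1 hlt
    obtain ⟨w, hw, hwc⟩ := hG_conc.exists_multiplier_mem_orthogonal hX hU_ne hU_closed hU_bdd
      hG_cont (c := c) fun u hu huX => EReal.coe_lt_coe_iff.1
        ((le_iSup₂_of_le (f := fun u (_ : u ∈ U ∩ (X : Set H)) => ((G u : ℝ) : EReal))
          u ⟨hu, huX⟩ le_rfl).trans_lt hc1)
    exact hc2.not_ge (iInf₂_le_of_le w hw (iSup₂_le fun u hu =>
      EReal.coe_le_coe_iff.2 (hwc u hu)))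
  exact ⟨h12.antisymm (h23.trans h31), h23.antisymm (h31.trans h12)⟩
end
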